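/- Let r ≥ 3 be a natural number. The following 8(r−1) functions on SL(3,ℂ)^r are algebraically independent over ℂ in the ℂ-algebra of all functions SL(3,ℂ)^r → ℂ: the eight functions tr(X₁), tr(X₂), tr(X₁⁻¹), tr(X₂⁻¹), tr(X₁X₂), tr(X₁⁻¹X₂), tr(X₂⁻¹X₁), tr(X₁⁻¹X₂⁻¹), together with, for each k with 3 ≤ k ≤ r, the eight functions tr(X_k), tr(X_k⁻¹), tr(X₁X_k), tr(X₂X_k), tr(X₁X_k⁻¹), tr(X₁⁻¹X_k⁻¹), tr(X₂X_k⁻¹), tr(X₂⁻¹X_k⁻¹). -/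

import Mathlib

/-- `SL(3,ℂ)`. -/
abbrev SL3 := Matrix.SpecialLinearGroup (Fin 3) ℂ

/-- Trace of an element of `SL(3,ℂ)`, as the trace of the underlying matrix. -/
noncomputable def tr3 (X : SL3) : ℂ := Matrix.trace (X : Matrix (Fin 3) (Fin 3) ℂ)

/-- The eight functions tr X₁, tr X₂, tr X₁⁻¹, tr X₂⁻¹, tr X₁X₂, tr X₁⁻¹X₂,
tr X₂⁻¹X₁, tr X₁⁻¹X₂⁻¹ (indices here are 0-based: X₁ = X 0, X₂ = X 1). -/
noncomputable def baseBlock (r : ℕ) (hr : 3 ≤ r) (j : Fin 8) (X : Fin r → SL3) : ℂ :=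
  ![tr3 (X ⟨0, by omega⟩),
    tr3 (X ⟨1, by omega⟩),
    tr3 (X ⟨0, by omega⟩)⁻¹,
    tr3 (X ⟨1, by omega⟩)⁻¹,
    tr3 (X ⟨0, by omega⟩ * X ⟨1, by omega⟩),
    tr3 ((X ⟨0, by omega⟩)⁻¹ * X ⟨1, by omega⟩),
    tr3 ((X ⟨1, by omega⟩)⁻¹ * X ⟨0, by omega⟩),
    tr3 ((X ⟨0, by omega⟩)⁻¹ * (X ⟨1, by omega⟩)⁻¹)] j


/-- Eight one-parameter unipotent curves through the identity, spanning `sl(3)` at `0`. -/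
noncomputable def unipMat (i : Fin 8) (s : ℂ) : Matrix (Fin 3) (Fin 3) ℂ :=
  ![!![1, s, 0; 0, 1, 0; 0, 0, 1],
    !![1, 0, s; 0, 1, 0; 0, 0, 1],
    !![1, 0, 0; s, 1, 0; 0, 0, 1],
    !![1, 0, 0; 0, 1, s; 0, 0, 1],
    !![1, 0, 0; 0, 1, 0; s, 0, 1],
    !![1, 0, 0; 0, 1, 0; 0, s, 1],
    !![1 + s, -s, 0; s, 1 - s, 0; 0, 0, 1],
    !![1, 0, 0; 0, 1 + s, -s; 0, s, 1 - s]] i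

noncomputable def unip (i : Fin 8) (s : ℂ) : SL3 :=
  ⟨unipMat i s, by
    fin_cases i <;> simp [unipMat, Matrix.det_fin_three] <;> ring⟩

theorem unip_zero (i : Fin 8) : unip i 0 = 1 := by
  apply Subtype.ext
  change unipMat i 0 = 1
  fin_cases i <;> simp [unipMat, Matrix.one_fin_three]

noncomputable def ptA : SL3 :=
  ⟨!![0, 0, -1; -1, 0, 0; 0, 1, 0], by simp [Matrix.det_fin_three]⟩
noncomputable def ptB : SL3 :=
  ⟨!![0, 0, -1; 0, -1, 0; -1, 1, 0], by simp [Matrix.det_fin_three]⟩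
noncomputable def ptX : SL3 :=
  ⟨!![0, 0, 1; -1, 0, 0; 0, -1, 0], by simp [Matrix.det_fin_three]⟩

theorem coe_unip (i : Fin 8) (s : ℂ) :
    (unip i s : Matrix (Fin 3) (Fin 3) ℂ) = unipMat i s := rfl

theorem coe_unip_inv (i : Fin 8) (s : ℂ) :
    ((unip i s)⁻¹ : SL3).1 = unipMat i (-s) := by
  rw [Matrix.SpecialLinearGroup.coe_inv, coe_unip]
  fin_cases i <;> simp [unipMat, Matrix.adjugate_fin_three_of] <;> ring_nf <;> simp

theorem coe_ptA : ptA.1 = !![0, 0, -1; -1, 0, 0; 0, 1, 0] := rfl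

theorem coe_ptA_inv : (ptA⁻¹ : SL3).1 = !![0, -1, 0; 0, 0, 1; -1, 0, 0] := by
  rw [Matrix.SpecialLinearGroup.coe_inv, coe_ptA, Matrix.adjugate_fin_three_of]
  norm_num

theorem coe_ptB : ptB.1 = !![0, 0, -1; 0, -1, 0; -1, 1, 0] := rfl

theorem coe_ptB_inv : (ptB⁻¹ : SL3).1 = !![0, -1, -1; 0, -1, 0; -1, 0, 0] := by
  rw [Matrix.SpecialLinearGroup.coe_inv, coe_ptB, Matrix.adjugate_fin_three_of]
  norm_num

theorem coe_ptX : ptX.1 = !![0, 0, 1; -1, 0, 0; 0, -1, 0] := rfl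

theorem coe_ptX_inv : (ptX⁻¹ : SL3).1 = !![0, -1, 0; 0, 0, -1; 1, 0, 0] := by
  rw [Matrix.SpecialLinearGroup.coe_inv, coe_ptX, Matrix.adjugate_fin_three_of]
  norm_num

noncomputable def gB (A B : SL3) : Fin 8 → ℂ :=
  ![tr3 A, tr3 B, tr3 A⁻¹, tr3 B⁻¹, tr3 (A * B), tr3 (A⁻¹ * B), tr3 (B⁻¹ * A), tr3 (A⁻¹ * B⁻¹)]

noncomputable def gK (A B X : SL3) : Fin 8 → ℂ :=
  ![tr3 X, tr3 X⁻¹, tr3 (A * X), tr3 (B * X), tr3 (A * X⁻¹), tr3 (A⁻¹ * X⁻¹), tr3 (B * X⁻¹),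
    tr3 (B⁻¹ * X⁻¹)]

/-- Columns: the derivatives of `gK` in the last variable. -/
noncomputable def jacK : Matrix (Fin 8) (Fin 8) ℂ :=
  !![-1, 0, 0, 1, 0, -1, -1, -1;
     0, -1, -1, -1, 0, 0, 0, 0;
     0, 1, 1, 1, 0, 0, -1, -1;
     -1, 0, 0, 0, 0, 1, 0, 1;
     1, 0, 0, 0, 0, 1, 0, 0;
     0, 1, -1, 0, 0, 0, 0, 0;
     1, 1, 1, 0, -2, 1, -1, 0;
     1, 1, -1, 1, 0, -1, 0, -2]

noncomputable def jacA : Matrix (Fin 8) (Fin 8) ℂ :=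
  !![-1, 0, 0, 0, 1, 1, 1, 1;
     0, 0, 1, 0, -1, 0, 0, 0;
     0, 0, 1, 0, -1, -1, -1, -1;
     1, 0, 0, 0, 0, 0, 0, -1;
     -1, 0, 0, 0, 0, 0, 0, 0;
     0, 0, -1, 0, 0, 0, 0, 0;
     1, 0, 1, 0, -2, -1, -1, -2;
     -1, 0, -1, 0, -1, 0, -1, 2]

noncomputable def jacB : Matrix (Fin 8) (Fin 8) ℂ :=
  !![0, 0, 0, 0, 0, -1, -1, 0;
     0, -1, 0, 1, 0, 0, 0, 0;
     0, 0, 0, 1, -1, 1, 1, 0;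
     0, 1, 0, 0, -1, 0, 0, -1;
     0, -1, 0, 1, 0, 0, 0, 1;
     0, 0, 0, 0, 1, 0, 0, 1;
     0, 1, 0, 0, 0, 1, 1, -1;
     0, -2, 0, 1, 2, 0, 1, 2]

set_option maxHeartbeats 4000000 in
theorem gK_line (i j : Fin 8) (s : ℂ) :
    gK ptA ptB (ptX * unip i s) j = gK ptA ptB ptX j + s * jacK i j := by
  fin_cases i <;> fin_cases j <;> change tr3 _ = tr3 _ + s * _ <;>
    simp [tr3, mul_inv_rev, -Matrix.SpecialLinearGroup.coe_inv, coe_ptA, coe_ptB, coe_ptX,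
      coe_ptA_inv, coe_ptB_inv, coe_ptX_inv, coe_unip, coe_unip_inv, unipMat, jacK,
      Matrix.trace_fin_three] <;> ring

set_option maxHeartbeats 4000000 in
theorem gB_lineA (i j : Fin 8) (s : ℂ) :
    gB (ptA * unip i s) ptB j = gB ptA ptB j + s * jacA i j := by
  fin_cases i <;> fin_cases j <;> change tr3 _ = tr3 _ + s * _ <;>
    simp [tr3, mul_inv_rev, -Matrix.SpecialLinearGroup.coe_inv, coe_ptA, coe_ptB, coe_ptX,
      coe_ptA_inv, coe_ptB_inv, coe_ptX_inv, coe_unip, coe_unip_inv, unipMat, jacA,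
      Matrix.trace_fin_three] <;> ring

set_option maxHeartbeats 4000000 in
theorem gB_lineB (i j : Fin 8) (s : ℂ) :
    gB ptA (ptB * unip i s) j = gB ptA ptB j + s * jacB i j := by
  fin_cases i <;> fin_cases j <;> change tr3 _ = tr3 _ + s * _ <;>
    simp [tr3, mul_inv_rev, -Matrix.SpecialLinearGroup.coe_inv, coe_ptA, coe_ptB, coe_ptX,
      coe_ptA_inv, coe_ptB_inv, coe_ptX_inv, coe_unip, coe_unip_inv, unipMat, jacB,
      Matrix.trace_fin_three] <;> ring

theorem jacK_inj (c : Fin 8 → ℂ) (h : ∀ i, ∑ j, c j * jacK i j = 0) : c = 0 := by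
  have h0 := h 0
  have h1 := h 1
  have h2 := h 2
  have h3 := h 3
  have h4 := h 4
  have h5 := h 5
  have h6 := h 6
  have h7 := h 7
  simp [Fin.sum_univ_eight, jacK] at h0 h1 h2 h3 h4 h5 h6 h7
  funext j
  fin_cases j <;> simp <;> grind

theorem jacAB_inj (c : Fin 8 → ℂ) (hA : ∀ i, ∑ j, c j * jacA i j = 0)
    (hB : ∀ i, ∑ j, c j * jacB i j = 0) : c = 0 := by
  have h0 := hA 0
  have h1 := hA 1
  have h2 := hA 2
  have h3 := hA 3
  have h4 := hA 4
  have h5 := hA 5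
  have h6 := hA 6
  have h7 := hA 7
  have k0 := hB 0
  have k1 := hB 1
  have k2 := hB 2
  have k3 := hB 3
  have k4 := hB 4
  have k5 := hB 5
  have k6 := hB 6
  have k7 := hB 7
  simp [Fin.sum_univ_eight, jacA, jacB] at h0 h1 h2 h3 h4 h5 h6 h7 k0 k1 k2 k3 k4 k5 k6 k7
  funext j
  fin_cases j <;> simp <;> grind

/-- Smoothness of an `SL(3,ℂ)`-valued function, entrywise. -/
def SmoothSL {V : Type*} [NormedAddCommGroup V] [NormedSpace ℂ V] (f : V → SL3) : Prop :=
  ∀ i j, ContDiff ℂ 1 (fun v => (f v : Matrix (Fin 3) (Fin 3) ℂ) i j)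

section smooth
variable {V : Type*} [NormedAddCommGroup V] [NormedSpace ℂ V]

theorem SmoothSL.mul {f g : V → SL3} (hf : SmoothSL f) (hg : SmoothSL g) :
    SmoothSL (fun v => f v * g v) := by
  intro i j
  simp only [Matrix.SpecialLinearGroup.coe_mul, Matrix.mul_apply]
  exact ContDiff.sum fun k _ => (hf i k).mul (hg k j)

theorem SmoothSL.inv {f : V → SL3} (hf : SmoothSL f) : SmoothSL (fun v => (f v)⁻¹) := by
  intro i j
  simp only [Matrix.SpecialLinearGroup.coe_inv, Matrix.adjugate_fin_three]
  have h := hf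
  unfold SmoothSL at h
  have h' : ∀ a b c d : Fin 3, ContDiff ℂ 1 (fun v => (f v : Matrix (Fin 3) (Fin 3) ℂ) a b *
    (f v : Matrix (Fin 3) (Fin 3) ℂ) c d) := fun a b c d => (h a b).mul (h c d)
  fin_cases i <;> fin_cases j <;> simp <;>
    first
    | exact (h' _ _ _ _).sub (h' _ _ _ _)
    | exact (h' _ _ _ _).neg.add (h' _ _ _ _)

theorem SmoothSL.tr {f : V → SL3} (hf : SmoothSL f) : ContDiff ℂ 1 (fun v => tr3 (f v)) := by
  simp only [tr3, Matrix.trace_fin_three]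
  exact ((hf 0 0).add (hf 1 1)).add (hf 2 2)

theorem SmoothSL.const (A : SL3) : SmoothSL (fun _ : V => A) := fun _ _ => contDiff_const

theorem SmoothSL.unip (i : Fin 8) {f : V → ℂ} (hf : ContDiff ℂ 1 f) :
    SmoothSL (fun v => unip i (f v)) := by
  intro a b
  have h1 : ContDiff ℂ 1 (fun v => 1 + f v) := contDiff_const.add hf
  have h2 : ContDiff ℂ 1 (fun v => 1 - f v) := contDiff_const.sub hf
  have h3 : ContDiff ℂ 1 (fun v => - f v) := hf.neg
  have h0 : ∀ c : ℂ, ContDiff ℂ 1 (fun _ : V => c) := fun c => contDiff_const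
  change ContDiff ℂ 1 (fun v => unipMat i (f v) a b)
  fin_cases i <;> fin_cases a <;> fin_cases b <;> simp [unipMat] <;>
    first
    | exact h0 _
    | exact hf
    | exact h1
    | exact h2
    | exact h3

theorem gB_smooth {f g : V → SL3} (hf : SmoothSL f) (hg : SmoothSL g) (j : Fin 8) :
    ContDiff ℂ 1 (fun v => gB (f v) (g v) j) := by
  fin_cases j
  · exact hf.tr
  · exact hg.tr
  · exact hf.inv.tr
  · exact hg.inv.tr
  · exact (hf.mul hg).tr
  · exact (hf.inv.mul hg).tr
  · exact (hg.inv.mul hf).tr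
  · exact (hf.inv.mul hg.inv).tr

theorem gK_smooth {f g h : V → SL3} (hf : SmoothSL f) (hg : SmoothSL g) (hh : SmoothSL h)
    (j : Fin 8) : ContDiff ℂ 1 (fun v => gK (f v) (g v) (h v) j) := by
  fin_cases j
  · exact hh.tr
  · exact hh.inv.tr
  · exact (hf.mul hh).tr
  · exact (hg.mul hh).tr
  · exact (hf.mul hh.inv).tr
  · exact (hf.inv.mul hh.inv).tr
  · exact (hg.mul hh.inv).tr
  · exact (hg.inv.mul hh.inv).tr
end smooth

/-- Product of the eight unipotent curves. -/
noncomputable def par (t : Fin 8 → ℂ) : SL3 :=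
  unip 0 (t 0) * unip 1 (t 1) * unip 2 (t 2) * unip 3 (t 3) * unip 4 (t 4) * unip 5 (t 5) *
    unip 6 (t 6) * unip 7 (t 7)

theorem par_zero : par (fun _ => 0) = 1 := by simp [par, unip_zero]

theorem par_single (i : Fin 8) (s : ℂ) : par (Pi.single i s) = unip i s := by
  fin_cases i <;> simp [par, unip_zero, Pi.single_apply]

noncomputable def basePt (n : ℕ) : SL3 := if n = 0 then ptA else if n = 1 then ptB else ptX

noncomputable def tup (r : ℕ) (T : Fin r × Fin 8 → ℂ) (k : Fin r) : SL3 :=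
  basePt k * par (fun i => T (k, i))

theorem tup_smooth (r : ℕ) (k : Fin r) : SmoothSL (fun T => tup r T k) := by
  have h : ∀ i, ContDiff ℂ 1 (fun T : Fin r × Fin 8 → ℂ => T (k, i)) :=
    fun i => contDiff_apply ℂ ℂ (k, i)
  unfold tup par
  exact (SmoothSL.const _).mul
    ((((((((SmoothSL.unip 0 (h 0)).mul (SmoothSL.unip 1 (h 1))).mul (SmoothSL.unip 2 (h 2))).mul
      (SmoothSL.unip 3 (h 3))).mul (SmoothSL.unip 4 (h 4))).mul (SmoothSL.unip 5 (h 5))).mul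
      (SmoothSL.unip 6 (h 6))).mul (SmoothSL.unip 7 (h 7)))

theorem tup_same (r : ℕ) (k : Fin r) (i : Fin 8) (s : ℂ) :
    tup r (s • Pi.single (k, i) 1) k = basePt k * unip i s := by
  rw [tup, ← par_single]
  congr 2
  funext j
  by_cases h : j = i
  · subst h; simp
  · simp [Pi.single_apply, h]

theorem tup_ne (r : ℕ) (k l : Fin r) (hl : l ≠ k) (i : Fin 8) (s : ℂ) :
    tup r (s • Pi.single (k, i) 1) l = basePt l := by
  have : (fun j => (s • (Pi.single (k, i) 1 : Fin r × Fin 8 → ℂ)) (l, j)) = fun _ => 0 := by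
    funext j
    simp [Pi.single_apply, hl]
  rw [tup, this, par_zero, mul_one]

/-- The whole family, composed with the parametrization. -/
noncomputable def Phi (r : ℕ) (hr : 3 ≤ r) (T : Fin r × Fin 8 → ℂ) :
    Fin 8 ⊕ ({k : Fin r // 2 ≤ (k : ℕ)} × Fin 8) → ℂ :=
  Sum.elim (gB (tup r T ⟨0, by omega⟩) (tup r T ⟨1, by omega⟩))
    (fun p => gK (tup r T ⟨0, by omega⟩) (tup r T ⟨1, by omega⟩) (tup r T p.1.1) p.2)

theorem Phi_smooth (r : ℕ) (hr : 3 ≤ r) : ContDiff ℂ 1 (Phi r hr) := by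
  rw [contDiff_pi]
  rintro (j | p)
  · exact gB_smooth (tup_smooth r _) (tup_smooth r _) j
  · exact gK_smooth (tup_smooth r _) (tup_smooth r _) (tup_smooth r _) p.2

theorem fderiv_of_line {V ι : Type*} [NormedAddCommGroup V] [NormedSpace ℂ V] [Fintype ι]
    (F : V → ι → ℂ) (hF : ContDiff ℂ 1 F) (v : V) (a : ι) (x y : ℂ)
    (h : ∀ s : ℂ, F (s • v) a = x + s * y) : fderiv ℂ F 0 v a = y := by
  have h1 : HasFDerivAt F (fderiv ℂ F 0) ((0 : ℂ) • v) := by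
    rw [zero_smul]
    exact (hF.differentiable one_ne_zero 0).hasFDerivAt
  have h2 : HasDerivAt (fun s : ℂ => s • v) v 0 := by
    simpa using (hasDerivAt_id (0 : ℂ)).smul_const v
  have h3 := hasDerivAt_pi.1 (h1.comp_hasDerivAt (0 : ℂ) h2) a
  have h4 : HasDerivAt (fun s : ℂ => x + s * y) y 0 := by
    simpa using ((hasDerivAt_id (0 : ℂ)).mul_const y).const_add x
  refine h3.unique ?_
  have h5 : (fun s : ℂ => (F ∘ fun s => s • v) s a) = fun s : ℂ => x + s * y := funext h
  rw [h5]
  exact h4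

theorem Phi_surj (r : ℕ) (hr : 3 ≤ r) :
    (fderiv ℂ (Phi r hr) 0).toLinearMap.range = ⊤ := by
  by_contra hne
  obtain ⟨f, hf0, hf⟩ := Submodule.exists_le_ker_of_lt_top _ (lt_top_iff_ne_top.2 hne)
  have hsm := Phi_smooth r hr
  apply hf0
  set c : Fin 8 ⊕ ({k : Fin r // 2 ≤ (k : ℕ)} × Fin 8) → ℂ := fun a => f (Pi.single a 1) with hc
  have hfc : ∀ y, f y = ∑ a, c a * y a := by
    intro y
    conv_lhs => rw [← Finset.univ_sum_single y]
    rw [map_sum]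
    refine Finset.sum_congr rfl fun a _ => ?_
    have : (Pi.single a (y a) : _ → ℂ) = y a • Pi.single a 1 := by
      rw [← Pi.single_smul]; simp
    rw [this, map_smul, smul_eq_mul, mul_comm]
  have key : ∀ v, ∑ a, c a * fderiv ℂ (Phi r hr) 0 v a = 0 := by
    intro v
    rw [← hfc]
    exact hf ⟨v, rfl⟩
  have b0 : basePt 0 = ptA := rfl
  have b1 : basePt 1 = ptB := rfl
  have b2 : ∀ n, 2 ≤ n → basePt n = ptX := by
    intro n hn
    rw [basePt, if_neg (by omega), if_neg (by omega)]
  have hK : ∀ p, c (Sum.inr p) = 0 := by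
    rintro ⟨k, j⟩
    have : (fun j => c (Sum.inr (k, j))) = 0 := by
      apply jacK_inj
      intro i
      have hk := k.2
      have n0 : (⟨0, by omega⟩ : Fin r) ≠ k.1 := by
        intro h; rw [← h] at hk; simp at hk
      have n1 : (⟨1, by omega⟩ : Fin r) ≠ k.1 := by
        intro h; rw [← h] at hk; simp at hk
      have h := key (Pi.single (k.1, i) 1)
      rw [Fintype.sum_sum_type, Fintype.sum_prod_type, Finset.sum_eq_zero, zero_add,
        Finset.sum_eq_single k] at h
      · rw [← h]
        refine Finset.sum_congr rfl fun j _ => ?_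
        congr 1
        symm
        apply fderiv_of_line _ hsm _ _ (gK ptA ptB ptX j)
        intro s
        simp only [Phi, Sum.elim_inr]
        rw [tup_ne _ _ _ n0, tup_ne _ _ _ n1, tup_same, b0, b1, b2 _ hk, gK_line]
      · intro l _ hl
        refine Finset.sum_eq_zero fun j _ => ?_
        rw [fderiv_of_line _ hsm _ _ (gK ptA ptB ptX j) 0, mul_zero]
        intro s
        simp only [Phi, Sum.elim_inr]
        rw [tup_ne _ _ _ n0, tup_ne _ _ _ n1, tup_ne _ _ _ (fun h => hl (Subtype.ext h)),
          b0, b1, b2 _ l.2]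
        simp
      · simp
      · intro j _
        rw [fderiv_of_line _ hsm _ _ (gB ptA ptB j) 0, mul_zero]
        intro s
        simp only [Phi, Sum.elim_inl]
        rw [tup_ne _ _ _ n0, tup_ne _ _ _ n1, b0, b1]
        simp
    exact congrFun this j
  have key2 : ∀ v, ∑ j, c (Sum.inl j) * fderiv ℂ (Phi r hr) 0 v (Sum.inl j) = 0 := by
    intro v
    have h := key v
    rw [Fintype.sum_sum_type] at h
    simpa [hK] using h
  have n01 : (⟨0, by omega⟩ : Fin r) ≠ ⟨1, by omega⟩ := by simp
  have hB : (fun j => c (Sum.inl j)) = 0 := by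
    apply jacAB_inj
    · intro i
      rw [← key2 (Pi.single (⟨0, by omega⟩, i) 1)]
      refine Finset.sum_congr rfl fun j _ => ?_
      congr 1
      symm
      apply fderiv_of_line _ hsm _ _ (gB ptA ptB j)
      intro s
      simp only [Phi, Sum.elim_inl]
      rw [tup_same, tup_ne _ _ _ n01.symm, b0, b1, gB_lineA]
    · intro i
      rw [← key2 (Pi.single (⟨1, by omega⟩, i) 1)]
      refine Finset.sum_congr rfl fun j _ => ?_
      congr 1
      symm
      apply fderiv_of_line _ hsm _ _ (gB ptA ptB j)
      intro s
      simp only [Phi, Sum.elim_inl]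
      rw [tup_same, tup_ne _ _ _ n01, b0, b1, gB_lineB]
  ext a
  change c a = 0
  rcases a with j | p
  · exact congrFun hB j
  · exact hK p

theorem mvpoly_zero_of_nhds {ι : Type*} [Fintype ι] (p : MvPolynomial ι ℂ) (y : ι → ℂ)
    (h : {z | MvPolynomial.eval z p = 0} ∈ nhds y) : p = 0 := by
  obtain ⟨ε, hε, hb⟩ := Metric.mem_nhds_iff.1 h
  refine MvPolynomial.funext_set (fun i => Metric.ball (y i) ε) (fun i => ?_) fun z hz => ?_
  · exact infinite_of_mem_nhds (y i) (Metric.ball_mem_nhds _ hε)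
  · rw [← ball_pi y hε] at hz
    simpa using hb hz

theorem trace_functions_algebraically_independent
    (r : ℕ) (hr : 3 ≤ r) :
    AlgebraicIndependent ℂ
      (Sum.elim (fun j : Fin 8 => baseBlock r hr j)
        (fun p : {k : Fin r // 2 ≤ (k : ℕ)} × Fin 8 => fun X : Fin r → SL3 =>
          ![tr3 (X p.1.1),
            tr3 (X p.1.1)⁻¹,
            tr3 (X ⟨0, by omega⟩ * X p.1.1),
            tr3 (X ⟨1, by omega⟩ * X p.1.1),
            tr3 (X ⟨0, by omega⟩ * (X p.1.1)⁻¹),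
            tr3 ((X ⟨0, by omega⟩)⁻¹ * (X p.1.1)⁻¹),
            tr3 (X ⟨1, by omega⟩ * (X p.1.1)⁻¹),
            tr3 ((X ⟨1, by omega⟩)⁻¹ * (X p.1.1)⁻¹)] p.2)) := by
  rw [algebraicIndependent_iff]
  intro p hp
  have hs := (Phi_smooth r hr).contDiffAt (x := 0) |>.hasStrictFDerivAt one_ne_zero
  have hn := hs.map_nhds_eq_of_surj (Phi_surj r hr)
  apply mvpoly_zero_of_nhds p (Phi r hr 0)
  rw [← hn, Filter.mem_map]
  refine Filter.Eventually.of_forall fun T => ?_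
  have h := congrArg (Pi.evalAlgHom ℂ (fun _ : Fin r → SL3 => ℂ) (tup r T)) hp
  rw [← AlgHom.comp_apply, MvPolynomial.comp_aeval, map_zero, MvPolynomial.aeval_eq_eval] at h
  simp only [Set.mem_ofPred_eq]
  refine Eq.trans ?_ h
  congr 2
  funext a
  rcases a with j | q <;> rfl
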